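/- For any Z = [Z_1, …, Z_K] ∈ ℝ^{d×m} with Z_k ∈ ℝ^{d×m_k}, the regularized MCR² objective satisfies F(Z) ≤ Σ_{k=1}^K ( (1/2) log det(I_d + α Z_k Z_kᵀ) − (m_k/(2m)) log det(I_d + α_k Z_k Z_kᵀ) − (λ/2)‖Z_k‖_F² ), and equality holds if and only if Z_kᵀZ_l = 0 for all 1 ≤ k ≠ l ≤ K. -/

import Mathlib

open Matrix BigOperators Finset

noncomputable section

/-- The `k`-th block of columns of the feature matrix `Z`. -/
def blk {d K : ℕ} (mk : Fin K → ℕ) (Z : Matrix (Fin d) ((k : Fin K) × Fin (mk k)) ℝ)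
    (k : Fin K) : Matrix (Fin d) (Fin (mk k)) ℝ :=
  Matrix.of fun i j => Z i ⟨k, j⟩

/-- Squared Frobenius norm. -/
def frobSq {n m : Type*} [Fintype n] [Fintype m] (A : Matrix n m ℝ) : ℝ :=
  ∑ i, ∑ j, A i j ^ 2

/-- The (lossy) coding rate `(1/2) log det (I + a • A * Aᵀ)`. -/
def codingRate {d : ℕ} {n : Type*} [Fintype n] (a : ℝ) (A : Matrix (Fin d) n ℝ) : ℝ :=
  (1 / 2) * Real.log ((1 + a • (A * Aᵀ)).det)

/-- Total number of samples `m = ∑ k, m_k`. -/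
def mTot {K : ℕ} (mk : Fin K → ℕ) : ℕ := ∑ k, mk k

/-- `α = d / (m ε²)`. -/
def alph (d : ℕ) {K : ℕ} (mk : Fin K → ℕ) (ε : ℝ) : ℝ :=
  (d : ℝ) / ((mTot mk : ℝ) * ε ^ 2)

/-- `α_k = d / (m_k ε²)`. -/
def alphK (d : ℕ) {K : ℕ} (mk : Fin K → ℕ) (ε : ℝ) (k : Fin K) : ℝ :=
  (d : ℝ) / ((mk k : ℝ) * ε ^ 2)

/-- The regularized MCR² objective
`F(Z) = R(Z) − ∑ k (m_k/m) R_c(Z_k) − (λ/2) ‖Z‖_F²`. -/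
def mcr2F (d K : ℕ) (mk : Fin K → ℕ) (ε lam : ℝ)
    (Z : Matrix (Fin d) ((k : Fin K) × Fin (mk k)) ℝ) : ℝ :=
  codingRate (alph d mk ε) Z
    - ∑ k, ((mk k : ℝ) / (mTot mk : ℝ)) * codingRate (alphK d mk ε k) (blk mk Z k)
    - (lam / 2) * frobSq Z

/-- The first-order (criticality) condition `∇F(Z) = 0`, i.e.
`α (I + α Z Zᵀ)⁻¹ Z_k − α (I + α_k Z_k Z_kᵀ)⁻¹ Z_k − λ Z_k = 0` for all `k`. -/
def IsCriticalPt (d K : ℕ) (mk : Fin K → ℕ) (ε lam : ℝ)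
    (Z : Matrix (Fin d) ((k : Fin K) × Fin (mk k)) ℝ) : Prop :=
  ∀ k : Fin K,
    alph d mk ε • ((1 + alph d mk ε • (Z * Zᵀ))⁻¹ * blk mk Z k)
      - alph d mk ε • ((1 + alphK d mk ε k • (blk mk Z k * (blk mk Z k)ᵀ))⁻¹ * blk mk Z k)
      - lam • blk mk Z k = 0

/-- Second derivative of `f` at `Z` along direction `D`, `∇²f(Z)[D,D]`. -/
def hessAlong {d K : ℕ} {mk : Fin K → ℕ}
    (f : Matrix (Fin d) ((k : Fin K) × Fin (mk k)) ℝ → ℝ)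
    (Z D : Matrix (Fin d) ((k : Fin K) × Fin (mk k)) ℝ) : ℝ :=
  iteratedDeriv 2 (fun t : ℝ => f (Z + t • D)) 0

/-- Upper bound for the regularization parameter:
`d (√(m/m_max) − 1) / (m (√(m/m_max) + 1) ε²)`. -/
def lamBound (d : ℕ) {K : ℕ} (mk : Fin K → ℕ) (ε : ℝ) : ℝ :=
  (d : ℝ) * (Real.sqrt ((mTot mk : ℝ) / ((Finset.univ.sup mk : ℕ) : ℝ)) - 1) /
    ((mTot mk : ℝ) * (Real.sqrt ((mTot mk : ℝ) / ((Finset.univ.sup mk : ℕ) : ℝ)) + 1) * ε ^ 2)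

/-- `η_k = (α_k − α) − λ (m/m_k + 1)`. -/
def etaK (d : ℕ) {K : ℕ} (mk : Fin K → ℕ) (ε lam : ℝ) (k : Fin K) : ℝ :=
  (alphK d mk ε k - alph d mk ε) - lam * ((mTot mk : ℝ) / (mk k : ℝ) + 1)

/-- `σ̄_k = ((η_k + √(η_k² − 4λ²m/m_k)) / (2λα_k))^(1/2)`. -/
def sigBar (d : ℕ) {K : ℕ} (mk : Fin K → ℕ) (ε lam : ℝ) (k : Fin K) : ℝ :=
  Real.sqrt ((etaK d mk ε lam k
      + Real.sqrt (etaK d mk ε lam k ^ 2 - 4 * lam ^ 2 * ((mTot mk : ℝ) / (mk k : ℝ))))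
    / (2 * lam * alphK d mk ε k))

/-- `σ̲_k = ((η_k − √(η_k² − 4λ²m/m_k)) / (2λα_k))^(1/2)`. -/
def sigUnd (d : ℕ) {K : ℕ} (mk : Fin K → ℕ) (ε lam : ℝ) (k : Fin K) : ℝ :=
  Real.sqrt ((etaK d mk ε lam k
      - Real.sqrt (etaK d mk ε lam k ^ 2 - 4 * lam ^ 2 * ((mTot mk : ℝ) / (mk k : ℝ))))
    / (2 * lam * alphK d mk ε k))

namespace Matrix

variable {n : Type*}

theorem PosSemidef.posDef_one_add [DecidableEq n] {A : Matrix n n ℝ} (hA : A.PosSemidef) :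
    (1 + A).PosDef :=
  PosDef.one.add_posSemidef hA

variable [Fintype n]

open scoped MatrixOrder in
theorem PosSemidef.exists_eq_conjTranspose_mul_self {A : Matrix n n ℝ} (hA : A.PosSemidef) :
    ∃ B : Matrix n n ℝ, A = Bᴴ * B := by
  classical
  exact CStarAlgebra.nonneg_iff_eq_star_mul_self.mp hA.nonneg

variable [DecidableEq n]

theorem PosSemidef.one_add_trace_le_det {A : Matrix n n ℝ} (hA : A.PosSemidef) :
    1 + A.trace ≤ (1 + A).det := by
  have hprod (s : Finset n) :
      1 + ∑ i ∈ s, hA.1.eigenvalues i ≤ ∏ i ∈ s, (1 + hA.1.eigenvalues i) := by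
    induction s using Finset.induction_on with
    | empty => simp
    | insert a s ha ih =>
      rw [Finset.sum_insert ha, Finset.prod_insert ha]
      nlinarith [hA.eigenvalues_nonneg a,
        Finset.sum_nonneg fun i (_ : i ∈ s) => hA.eigenvalues_nonneg i]
  have hdet : (1 + A).det = ∏ i, (1 + hA.1.eigenvalues i) := by
    conv_lhs => rw [hA.1.spectral_theorem, Unitary.conjStarAlgAut_apply, Matrix.mul_assoc,
      det_one_add_mul_comm, Matrix.mul_assoc, Unitary.coe_star_mul_self, Matrix.mul_one,
      ← diagonal_one, diagonal_add, det_diagonal]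
    simp
  rw [hdet, hA.1.trace_eq_sum_eigenvalues]
  exact hprod univ

/-- The determinant is monotone in the Loewner order, strictly so at positive definite matrices. -/
theorem PosDef.det_le_det_add {S D : Matrix n n ℝ} (hS : S.PosDef) (hD : D.PosSemidef) :
    S.det ≤ (S + D).det ∧ ((S + D).det = S.det → D = 0) := by
  obtain ⟨E, rfl⟩ := hD.exists_eq_conjTranspose_mul_self
  have hM : (E * S⁻¹ * Eᴴ).PosSemidef := hS.inv.posSemidef.mul_mul_conjTranspose_same E
  have htr := hM.trace_nonneg
  have hle := hM.one_add_trace_le_det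
  have hpos := hS.det_pos
  rw [det_add_mul Eᴴ E hS.det_pos.ne'.isUnit]
  refine ⟨by nlinarith, fun h => ?_⟩
  have h1 : (1 + E * S⁻¹ * Eᴴ).det = 1 := by
    apply mul_left_cancel₀ hpos.ne'
    rw [h, mul_one]
  have h0 : E * S⁻¹ * Eᴴ = 0 := hM.trace_eq_zero_iff.1 (by linarith)
  obtain ⟨W, hW⟩ := hS.inv.posSemidef.exists_eq_conjTranspose_mul_self
  rw [hW] at h0
  have h2 : W * Eᴴ = 0 := by
    rw [← conjTranspose_mul_self_eq_zero, conjTranspose_mul, conjTranspose_conjTranspose]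
    simpa only [Matrix.mul_assoc] using h0
  have h3 : S⁻¹ * Eᴴ = 0 := by rw [hW, Matrix.mul_assoc, h2, Matrix.mul_zero]
  have h4 : Eᴴ = 0 := by
    rw [← mul_nonsing_inv_cancel_left S Eᴴ hpos.ne'.isUnit, h3, Matrix.mul_zero]
  rw [h4, Matrix.zero_mul]

/-- Submultiplicativity of `A ↦ det (1 + A)` under addition of positive semidefinite
matrices, with equality iff their product vanishes. -/
theorem PosSemidef.det_one_add_add_le {A B : Matrix n n ℝ} (hA : A.PosSemidef)
    (hB : B.PosSemidef) :
    (1 + (A + B)).det ≤ (1 + A).det * (1 + B).det ∧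
      ((1 + (A + B)).det = (1 + A).det * (1 + B).det ↔ A * B = 0) := by
  obtain ⟨Y, rfl⟩ := hB.exists_eq_conjTranspose_mul_self
  have hP := hA.posDef_one_add
  have hu : IsUnit (1 + A).det := hP.det_pos.ne'.isUnit
  set P := 1 + A with hPdef
  have hN : 1 - P⁻¹ = P⁻¹ * (A + Aᴴ * A) * (P⁻¹)ᴴ := by
    have h1 : A + Aᴴ * A = A * P := by
      rw [hPdef, hA.1.eq, Matrix.mul_add, Matrix.mul_one]
    rw [h1, hP.inv.1.eq, Matrix.mul_assoc, Matrix.mul_assoc, mul_nonsing_inv _ hu, Matrix.mul_one]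
    have h2 : A = P - 1 := by rw [hPdef, add_sub_cancel_left]
    conv_rhs => rw [h2, Matrix.mul_sub, nonsing_inv_mul _ hu, Matrix.mul_one]
  have hNpsd : (1 - P⁻¹).PosSemidef := by
    rw [hN]
    exact (hA.add (posSemidef_conjTranspose_mul_self A)).mul_mul_conjTranspose_same _
  have hS : (1 + Y * P⁻¹ * Yᴴ).PosDef :=
    (hP.inv.posSemidef.mul_mul_conjTranspose_same Y).posDef_one_add
  have hD := hNpsd.mul_mul_conjTranspose_same Y
  have hsum : 1 + Y * P⁻¹ * Yᴴ + Y * (1 - P⁻¹) * Yᴴ = 1 + Y * Yᴴ := by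
    rw [Matrix.mul_sub, Matrix.mul_one, Matrix.sub_mul]
    abel
  obtain ⟨hle, heq⟩ := hS.det_le_det_add hD
  rw [hsum, det_one_add_mul_comm Y Yᴴ] at hle heq
  have hdet : (1 + (A + Yᴴ * Y)).det = P.det * (1 + Y * P⁻¹ * Yᴴ).det := by
    rw [← add_assoc, ← hPdef, det_add_mul _ _ hu]
  refine ⟨?_, fun h => ?_, fun h => ?_⟩
  · rw [hdet]
    exact mul_le_mul_of_nonneg_left hle hP.det_pos.le
  · rw [hdet] at h
    have h0 := heq (mul_left_cancel₀ hP.det_pos.ne' h).symm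
    obtain ⟨W, hW⟩ := hNpsd.exists_eq_conjTranspose_mul_self
    rw [hW] at h0
    have h2 : W * Yᴴ = 0 := by
      rw [← conjTranspose_mul_self_eq_zero, conjTranspose_mul, conjTranspose_conjTranspose]
      simpa only [Matrix.mul_assoc] using h0
    have h3 : A = P * (1 - P⁻¹) := by
      rw [Matrix.mul_sub, mul_nonsing_inv _ hu, Matrix.mul_one, hPdef, add_sub_cancel_left]
    rw [h3, hW, Matrix.mul_assoc, Matrix.mul_assoc, ← Matrix.mul_assoc W, h2, Matrix.zero_mul,
      Matrix.mul_zero, Matrix.mul_zero]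
  · rw [← det_mul, hPdef, Matrix.add_mul, Matrix.one_mul, Matrix.mul_add, h, Matrix.mul_one,
      add_zero]
    congr 1
    abel

/-- Fischer-type inequality for a finite family of positive semidefinite matrices, with equality
iff their pairwise products vanish. -/
theorem PosSemidef.det_one_add_sum_le {ι : Type*} (s : Finset ι)
    {A : ι → Matrix n n ℝ} (hA : ∀ i, (A i).PosSemidef) :
    (1 + ∑ i ∈ s, A i).det ≤ ∏ i ∈ s, (1 + A i).det ∧
      ((1 + ∑ i ∈ s, A i).det = ∏ i ∈ s, (1 + A i).det ↔
        ∀ i ∈ s, ∀ j ∈ s, i ≠ j → A i * A j = 0) := by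
  classical
  have hcomm {i j : ι} (h : A i * A j = 0) : A j * A i = 0 := by
    have := congrArg Matrix.conjTranspose h
    rwa [conjTranspose_mul, (hA i).1.eq, (hA j).1.eq, conjTranspose_zero] at this
  induction s using Finset.induction_on with
  | empty => simp
  | insert a s ha ih =>
    obtain ⟨ihle, iheq⟩ := ih
    obtain ⟨hle, heq⟩ := (hA a).det_one_add_add_le (posSemidef_sum s fun i _ => hA i)
    have hpos := (hA a).posDef_one_add.det_pos
    have hmul := mul_le_mul_of_nonneg_left ihle hpos.le
    rw [Finset.sum_insert ha, Finset.prod_insert ha]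
    refine ⟨hle.trans hmul, fun h => ?_, fun h => ?_⟩
    · have hs := iheq.1 (mul_left_cancel₀ hpos.ne' (le_antisymm hmul (h ▸ hle)))
      have hz := heq.1 (le_antisymm hle (h ▸ hmul))
      have haj : ∀ j ∈ s, A a * A j = 0 := by
        intro j hj
        have hsq : (∑ i ∈ s, A i) * A j = A j * (A j)ᴴ := by
          rw [Finset.sum_mul, Finset.sum_eq_single_of_mem j hj fun i hi hij => hs i hi j hj hij,
            (hA j).1.eq]
        rw [← mul_self_mul_conjTranspose_eq_zero, ← hsq, ← Matrix.mul_assoc, hz, Matrix.zero_mul]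
      intro i hi j hj hij
      rcases Finset.mem_insert.1 hi with rfl | his <;> rcases Finset.mem_insert.1 hj with rfl | hjs
      · exact absurd rfl hij
      · exact haj j hjs
      · exact hcomm (haj i his)
      · exact hs i his j hjs hij
    · rw [heq.2, iheq.2 fun i hi j hj => h i (mem_insert_of_mem hi) j (mem_insert_of_mem hj)]
      rw [Finset.mul_sum]
      exact Finset.sum_eq_zero fun j hj => h a (mem_insert_self a s) j (mem_insert_of_mem hj)
        fun e => ha (e ▸ hj)

end Matrix

theorem mul_transpose_eq_sum_blk {d K : ℕ} (mk : Fin K → ℕ)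
    (Z : Matrix (Fin d) ((k : Fin K) × Fin (mk k)) ℝ) :
    Z * Zᵀ = ∑ k, blk mk Z k * (blk mk Z k)ᵀ := by
  ext i j
  simp [Matrix.mul_apply, Matrix.sum_apply, blk, Fintype.sum_sigma]

theorem frobSq_eq_sum_blk {d K : ℕ} (mk : Fin K → ℕ)
    (Z : Matrix (Fin d) ((k : Fin K) × Fin (mk k)) ℝ) :
    frobSq Z = ∑ k, frobSq (blk mk Z k) := by
  simp only [frobSq, blk, Fintype.sum_sigma, Matrix.of_apply]
  exact Finset.sum_comm

theorem alph_nonneg (d : ℕ) {K : ℕ} (mk : Fin K → ℕ) (ε : ℝ) : 0 ≤ alph d mk ε := by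
  unfold alph
  positivity

theorem alph_pos {d K : ℕ} {mk : Fin K → ℕ} {ε : ℝ} (hd : 0 < d) (hε : 0 < ε) {k : Fin K}
    (hk : 0 < mk k) : 0 < alph d mk ε := by
  have hm : 0 < mTot mk :=
    hk.trans_le (Finset.single_le_sum (fun i _ => Nat.zero_le (mk i)) (mem_univ k))
  unfold alph
  positivity

/-- **Lemma 4.1:** upper bound on the regularized MCR² objective, with equality iff
the blocks are pairwise orthogonal. -/
theorem mcr2F_upper_bound (d K : ℕ) (mk : Fin K → ℕ) (ε lam : ℝ)
    (hmk : ∀ k, 0 < mk k) (hε : 0 < ε) (hlam : 0 < lam)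
    (Z : Matrix (Fin d) ((k : Fin K) × Fin (mk k)) ℝ) :
    mcr2F d K mk ε lam Z ≤
      ∑ k, ((1 / 2) * Real.log ((1 + alph d mk ε • (blk mk Z k * (blk mk Z k)ᵀ)).det)
        - ((mk k : ℝ) / (2 * (mTot mk : ℝ)))
            * Real.log ((1 + alphK d mk ε k • (blk mk Z k * (blk mk Z k)ᵀ)).det)
        - (lam / 2) * frobSq (blk mk Z k)) ∧
    (mcr2F d K mk ε lam Z =
      ∑ k, ((1 / 2) * Real.log ((1 + alph d mk ε • (blk mk Z k * (blk mk Z k)ᵀ)).det)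
        - ((mk k : ℝ) / (2 * (mTot mk : ℝ)))
            * Real.log ((1 + alphK d mk ε k • (blk mk Z k * (blk mk Z k)ᵀ)).det)
        - (lam / 2) * frobSq (blk mk Z k)) ↔
      ∀ k l, k ≠ l → (blk mk Z k)ᵀ * blk mk Z l = 0) := by
  set a := alph d mk ε with ha
  set A : Fin K → Matrix (Fin d) (Fin d) ℝ := fun k => a • (blk mk Z k * (blk mk Z k)ᵀ) with hAdef
  have hA (k : Fin K) : (A k).PosSemidef := by
    have h := posSemidef_self_mul_conjTranspose (blk mk Z k)
    rw [conjTranspose_eq_transpose_of_trivial] at h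
    exact h.smul (alph_nonneg d mk ε)
  obtain ⟨hle, heq⟩ := PosSemidef.det_one_add_sum_le univ hA
  have hZ : a • (Z * Zᵀ) = ∑ k, A k := by
    rw [mul_transpose_eq_sum_blk, Finset.smul_sum]
  have hpos : 0 < (1 + ∑ k, A k).det :=
    (posSemidef_sum univ fun k _ => hA k).posDef_one_add.det_pos
  have hposk (k : Fin K) : 0 < (1 + A k).det := (hA k).posDef_one_add.det_pos
  have hprod : 0 < ∏ k, (1 + A k).det := Finset.prod_pos fun k _ => hposk k
  have hF : mcr2F d K mk ε lam Z = (1 / 2) * Real.log (1 + ∑ k, A k).det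
      - ∑ k, ((mk k : ℝ) / (2 * (mTot mk : ℝ)))
          * Real.log ((1 + alphK d mk ε k • (blk mk Z k * (blk mk Z k)ᵀ)).det)
      - ∑ k, (lam / 2) * frobSq (blk mk Z k) := by
    rw [mcr2F, codingRate, ← ha, hZ, frobSq_eq_sum_blk, Finset.mul_sum]
    congr 2
    refine Finset.sum_congr rfl fun k _ => ?_
    rw [codingRate, ← mul_assoc, div_mul_div_comm, mul_one, mul_comm 2]
  have horth : (∀ i ∈ univ, ∀ j ∈ univ, i ≠ j → A i * A j = 0) ↔
      ∀ k l, k ≠ l → (blk mk Z k)ᵀ * blk mk Z l = 0 := by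
    simp only [mem_univ, true_imp_iff]
    refine forall_congr' fun k => forall_congr' fun l => imp_congr_right fun _ => ?_
    rcases Nat.eq_zero_or_pos d with rfl | hd
    · exact iff_of_true (Subsingleton.elim _ _) (by ext i j; simp [Matrix.mul_apply])
    · have hapos : a ≠ 0 := (alph_pos hd hε (hmk k)).ne'
      simp only [hAdef, Matrix.smul_mul, Matrix.mul_smul, smul_eq_zero, hapos, false_or,
        ← conjTranspose_eq_transpose_of_trivial]
      rw [self_mul_conjTranspose_mul_eq_zero, mul_self_mul_conjTranspose_eq_zero]
  rw [Finset.sum_sub_distrib, Finset.sum_sub_distrib, ← Finset.mul_sum,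
    ← Real.log_prod fun k _ => (hposk k).ne', hF]
  refine ⟨?_, ?_⟩
  · have := Real.log_le_log hpos hle
    linarith
  · rw [sub_left_inj, sub_left_inj, mul_right_inj' (by norm_num), ← horth, ← heq]
    exact ⟨fun h => Real.log_injOn_pos hpos hprod h, fun h => by rw [h]⟩


end
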